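/- arXiv:1309.3766 — 4 statements merged into one kernel-verified Lean document; each statement's English description precedes it below -/
import Mathlib

section
/- Let (L, h, (·,·)) be an extended affine Lie superalgebra over a field F of characteristic zero with root system R. For all α, β ∈ R with (α,α) ≠ 0, the scalar 2(β,α)/(α,α) ∈ F equals n·1_F for some integer n. In particular, if k ∈ F, α ∈ R with (α,α) ≠ 0 and kα ∈ R, then k ∈ {0, 1, -1, 2, -2, 1/2, -1/2}. -/
/-- A Lie superalgebra over `F`: a `ℤ/2`-graded vector space with a bilinear bracket
satisfying super skew-symmetry and the super Jacobi identity on homogeneous elements. -/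
structure LieSuperAlgebra (F : Type) [Field F] (L : Type) [AddCommGroup L] [Module F L] where
  bracket : L →ₗ[F] L →ₗ[F] L
  carrier : ZMod 2 → Submodule F L
  isCompl : IsCompl (carrier 0) (carrier 1)
  bracket_mem : ∀ i j : ZMod 2, ∀ x ∈ carrier i, ∀ y ∈ carrier j, bracket x y ∈ carrier (i + j)
  skew : ∀ i j : ZMod 2, ∀ x ∈ carrier i, ∀ y ∈ carrier j,
    bracket x y = -(((-1 : F) ^ (i.val * j.val)) • bracket y x)
  super_jacobi : ∀ i j : ZMod 2, ∀ x ∈ carrier i, ∀ y ∈ carrier j, ∀ z : L,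
    bracket (bracket x y) z
      = bracket x (bracket y z) - ((-1 : F) ^ (i.val * j.val)) • bracket y (bracket x z)

/-- A super-toral triple `(L, H, (·,·))`: a nonzero Lie superalgebra with a nontrivial
abelian subalgebra `H` of the even part, a nondegenerate invariant even supersymmetric
bilinear form whose restriction to `H` is nondegenerate, and a weight space decomposition
of `L` with respect to `H`. -/
structure SuperToral (F : Type) [Field F] (L : Type) [AddCommGroup L] [Module F L]
    extends LieSuperAlgebra F L where
  L_ne : ∃ x : L, x ≠ 0
  H : Submodule F L
  H_le : H ≤ carrier 0
  H_ne_bot : H ≠ ⊥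
  H_sub : ∀ x ∈ H, ∀ y ∈ H, bracket x y ∈ H
  form : L →ₗ[F] L →ₗ[F] F
  form_nondeg : ∀ x : L, (∀ y : L, form x y = 0) → x = 0
  form_inv : ∀ x y z : L, form (bracket x y) z = form x (bracket y z)
  form_even : ∀ x ∈ carrier 0, ∀ y ∈ carrier 1, form x y = 0
  form_super : ∀ i j : ZMod 2, ∀ x ∈ carrier i, ∀ y ∈ carrier j,
    form x y = ((-1 : F) ^ (i.val * j.val)) * form y x
  /-- The weight space attached to a linear functional on `H`. -/
  wt : Module.Dual F ↥H → Submodule F L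
  wt_def : ∀ (α : Module.Dual F ↥H) (x : L), x ∈ wt α ↔ ∀ t : ↥H, bracket ↑t x = α t • x
  /-- The weight spaces are independent … -/
  wt_indep : iSupIndep wt
  /-- … and they span `L`, i.e. `L = ⊕_α L^α`. -/
  wt_sup : (⨆ α : Module.Dual F ↥H, wt α) = ⊤
  form_H_nondeg : ∀ t : ↥H, (∀ s : ↥H, form ↑t ↑s = 0) → t = 0

/-- An extended affine Lie superalgebra: a super-toral triple such that (1) every nonzero
root space pair `(α, -α)` of fixed parity contains elements whose bracket is a nonzero
element of `H`, and (2) for every root `α` with `(α,α) ≠ 0` (expressed via a representative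
`t_α ∈ H` of `α` through the form), `ad x` is locally nilpotent for `x ∈ L^α`. -/
structure EALS (F : Type) [Field F] (L : Type) [AddCommGroup L] [Module F L]
    extends SuperToral F L where
  ax1 : ∀ i : ZMod 2, ∀ α : Module.Dual F ↥H, α ≠ 0 → carrier i ⊓ wt α ≠ ⊥ →
    ∃ x ∈ carrier i ⊓ wt α, ∃ y ∈ carrier i ⊓ wt (-α),
      bracket x y ∈ H ∧ bracket x y ≠ 0
  ax2 : ∀ α : Module.Dual F ↥H, wt α ≠ ⊥ →
    ∀ t : ↥H, (∀ s : ↥H, form ↑t ↑s = α s) → form ↑t ↑t ≠ 0 →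
    ∀ x ∈ wt α, ∀ y : L, ∃ n : ℕ, ((bracket x) ^ n) y = 0

section EndomorphismTriples

variable {F V : Type*} [Field F] [AddCommGroup V] [Module F V]

/-- If `f` shifts eigenvalues of `h` by `a`, then `f ^ n` shifts them by `n * a`. -/
theorem apply_pow_of_shift {f h : Module.End F V} {a μ : F} {v : V}
    (hf : ∀ u, h (f u) = f (h u) + a • f u) (hv : h v = μ • v) (n : ℕ) :
    h ((f ^ n) v) = (μ + n * a) • (f ^ n) v := by
  induction n with
  | zero => simp [hv]
  | succ n ih =>
    rw [pow_succ', Module.End.mul_apply, hf, ih, map_smul, ← add_smul]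
    congr 1
    push_cast
    ring

/-- A nonzero vector killed by some power of `f` has a last nonzero iterate. -/
theorem exists_pow_apply_ne_zero {f : Module.End F V} {v : V} (hv : v ≠ 0)
    (hn : ∃ n : ℕ, (f ^ n) v = 0) : ∃ n : ℕ, (f ^ n) v ≠ 0 ∧ f ((f ^ n) v) = 0 := by
  classical
  obtain ⟨n, hn0⟩ : ∃ n, Nat.find hn = n + 1 := by
    refine Nat.exists_eq_succ_of_ne_zero fun h0 => hv ?_
    have h1 := Nat.find_spec hn
    rw [h0] at h1
    simpa using h1
  refine ⟨n, Nat.find_min hn (by lia), ?_⟩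
  have h1 := Nat.find_spec hn
  rwa [hn0, pow_succ', Module.End.mul_apply] at h1

variable [CharZero F] {e f h : Module.End F V} {a μ : F} {v : V}

/-- Integrality of the eigenvalues of `h` for operators satisfying the relations of an
`sl₂`-triple with `e` and `f` locally nilpotent. -/
theorem exists_int_of_commutator
    (hef : ∀ u, e (f u) = h u + f (e u))
    (he : ∀ u, h (e u) = e (h u) + a • e u)
    (hf : ∀ u, h (f u) = f (h u) + (-a) • f u)
    (hne : ∀ u, ∃ n : ℕ, (e ^ n) u = 0) (hnf : ∀ u, ∃ n : ℕ, (f ^ n) u = 0)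
    (hv0 : v ≠ 0) (hv : h v = μ • v) : ∃ n : ℤ, 2 * μ = n * a := by
  obtain ⟨m, hm0, hm⟩ := exists_pow_apply_ne_zero hv0 (hne v)
  have hw := apply_pow_of_shift he hv m
  set w := (e ^ m) v
  set c := μ + m * a with hc
  have key : ∀ n : ℕ, 2 • e (f ((f ^ n) w)) = ((n + 1) * (2 * c - n * a)) • (f ^ n) w := by
    intro n
    induction n with
    | zero => simp [hef, hm, hw, two_smul, ← add_smul, two_mul]
    | succ n ih =>
      rw [hef, smul_add, apply_pow_of_shift hf hw, pow_succ', Module.End.mul_apply,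
        ← map_nsmul f, ih, map_smul, ← Nat.cast_smul_eq_nsmul F, smul_smul, ← add_smul]
      congr 1
      push_cast
      ring
  obtain ⟨n, hn0, hn⟩ := exists_pow_apply_ne_zero hm0 (hnf w)
  have h1 := key n
  rw [hn, map_zero, smul_zero, eq_comm, smul_eq_zero, or_iff_left hn0, mul_eq_zero,
    or_iff_right (by exact_mod_cast n.succ_ne_zero)] at h1
  refine ⟨n - 2 * m, ?_⟩
  push_cast
  linear_combination h1 - 2 * hc

/-- Integrality of the eigenvalues of `h` for operators satisfying the relations of the odd
generators of `osp(1|2)` with `e` and `f` locally nilpotent. -/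
theorem exists_int_of_anticommutator (ha : a ≠ 0)
    (hef : ∀ u, e (f u) = h u - f (e u))
    (he : ∀ u, h (e u) = e (h u) + a • e u)
    (hf : ∀ u, h (f u) = f (h u) + (-a) • f u)
    (hne : ∀ u, ∃ n : ℕ, (e ^ n) u = 0) (hnf : ∀ u, ∃ n : ℕ, (f ^ n) u = 0)
    (hv0 : v ≠ 0) (hv : h v = μ • v) : ∃ n : ℤ, μ = n * a := by
  obtain ⟨m, hm0, hm⟩ := exists_pow_apply_ne_zero hv0 (hne v)
  have hw := apply_pow_of_shift he hv m
  set w := (e ^ m) v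
  set c := μ + m * a with hc
  have step : ∀ (n : ℕ) (b : F), e (f ((f ^ n) w)) = b • (f ^ n) w →
      e (f ((f ^ (n + 1)) w)) = (c - (n + 1) * a - b) • (f ^ (n + 1)) w := by
    intro n b hb
    rw [hef, apply_pow_of_shift hf hw, pow_succ', Module.End.mul_apply, hb, map_smul, ← sub_smul]
    congr 1
    push_cast
    ring
  have even_step : ∀ k : ℕ, e (f ((f ^ (2 * k)) w)) = (c - k * a) • (f ^ (2 * k)) w := by
    intro k
    induction k with
    | zero => simp [hef, hm, hw]
    | succ k ih =>
      have h1 := step _ _ (step _ _ ih)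
      rw [show 2 * (k + 1) = 2 * k + 1 + 1 by ring, h1]
      congr 1
      push_cast
      ring
  obtain ⟨n, hn0, hn⟩ := exists_pow_apply_ne_zero hm0 (hnf w)
  obtain ⟨k, rfl | rfl⟩ := n.even_or_odd'
  · have h1 := even_step k
    rw [hn, map_zero, eq_comm, smul_eq_zero, or_iff_left hn0] at h1
    refine ⟨k - m, ?_⟩
    push_cast
    linear_combination h1 - hc
  · have h1 := step _ _ (even_step k)
    rw [hn, map_zero, eq_comm, smul_eq_zero, or_iff_left hn0] at h1
    have h2 : ((k : F) + 1) * a = 0 := by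
      push_cast at h1
      linear_combination -h1
    exact absurd h2 (mul_ne_zero (by exact_mod_cast k.succ_ne_zero) ha)

end EndomorphismTriples

namespace SuperToral

variable {F L : Type} [Field F] [AddCommGroup L] [Module F L] (E : SuperToral F L)
  {α : Module.Dual F E.H}

/-- A nonzero weight space contains a nonzero homogeneous vector. -/
theorem exists_carrier_inf_wt_ne_bot (hα : E.wt α ≠ ⊥) : ∃ i, E.carrier i ⊓ E.wt α ≠ ⊥ := by
  obtain ⟨z, hz, hz0⟩ := (Submodule.ne_bot_iff _).1 hα
  obtain ⟨a, ha, b, hb, rfl⟩ := Submodule.mem_sup.1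
    (E.isCompl.sup_eq_top ▸ Submodule.mem_top : z ∈ E.carrier 0 ⊔ E.carrier 1)
  have key : ∀ t : E.H, E.bracket t a = α t • a ∧ E.bracket t b = α t • b := by
    intro t
    have h1 := (E.wt_def α _).1 hz t
    rw [map_add, smul_add] at h1
    have h2 : E.bracket t a - α t • a = -(E.bracket t b - α t • b) := by
      rw [← sub_eq_zero, ← sub_eq_zero.2 h1]
      abel
    have h3 : E.bracket t a - α t • a ∈ E.carrier 0 :=
      sub_mem (E.bracket_mem 0 0 _ (E.H_le t.2) _ ha) (Submodule.smul_mem _ _ ha)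
    have h4 : E.bracket t b - α t • b ∈ E.carrier 1 :=
      sub_mem (E.bracket_mem 0 1 _ (E.H_le t.2) _ hb) (Submodule.smul_mem _ _ hb)
    have h5 := Submodule.disjoint_def.1 E.isCompl.disjoint _ h3 (h2 ▸ neg_mem h4)
    exact ⟨sub_eq_zero.1 h5, sub_eq_zero.1 (neg_eq_zero.1 (h2 ▸ h5))⟩
  by_cases ha0 : a = 0
  · refine ⟨1, (Submodule.ne_bot_iff _).2
      ⟨b, ⟨hb, (E.wt_def α b).2 fun t => (key t).2⟩, fun hb0 => hz0 ?_⟩⟩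
    rw [ha0, hb0, add_zero]
  · exact ⟨0, (Submodule.ne_bot_iff _).2 ⟨a, ⟨ha, (E.wt_def α a).2 fun t => (key t).1⟩, ha0⟩⟩

/-- The adjoint action of a weight vector shifts the adjoint action of `H`. -/
theorem bracket_bracket_of_mem_wt {i : ZMod 2} {x : L} (hxi : x ∈ E.carrier i)
    (hx : x ∈ E.wt α) (t : E.H) (u : L) :
    E.bracket t (E.bracket x u) = E.bracket x (E.bracket t u) + α t • E.bracket x u := by
  have h1 := E.super_jacobi i 0 x hxi t (E.H_le t.2) u
  rw [E.skew i 0 x hxi t (E.H_le t.2), (E.wt_def α x).1 hx t] at h1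
  simp only [ZMod.val_zero, mul_zero, pow_zero, one_smul, map_neg, map_smul, LinearMap.neg_apply,
    LinearMap.smul_apply] at h1
  rw [eq_sub_iff_add_eq] at h1
  rw [← h1]
  abel

/-- If `x` and `y` have opposite weights `α` and `-α` and `[x, y] ∈ H`, then
`[x, y] = (x, y) t_α`. -/
theorem bracket_eq_form_smul {x y : L} (hy : y ∈ E.wt (-α)) (hxy : E.bracket x y ∈ E.H)
    {i : ZMod 2} (hyi : y ∈ E.carrier i)
    {tα : E.H} (hrα : ∀ s : E.H, E.form tα s = α s) :
    (⟨E.bracket x y, hxy⟩ : E.H) = E.form x y • tα := by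
  refine sub_eq_zero.1 (E.form_H_nondeg _ fun s => ?_)
  have h1 : E.bracket y s = α s • y := by
    rw [E.skew i 0 y hyi s (E.H_le s.2), (E.wt_def _ y).1 hy s]
    simp
  simp [E.form_inv, h1, hrα, mul_comm]

end SuperToral

namespace EALS

variable {F L : Type} [Field F] [CharZero F] [AddCommGroup L] [Module F L] (E : EALS F L)
  {α β : Module.Dual F E.H}

/-- Integrality of `2(β,α)/(α,α)` for roots `α`, `β` with `(α,α) ≠ 0`. -/
theorem exists_int_two_mul_apply (hα : E.wt α ≠ ⊥) (hβ : E.wt β ≠ ⊥)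
    {tα : E.H} (hrα : ∀ s : E.H, E.form tα s = α s) (haa : α tα ≠ 0) :
    ∃ n : ℤ, 2 * β tα = n * α tα := by
  obtain ⟨i, hi⟩ := E.exists_carrier_inf_wt_ne_bot hα
  have hα0 : α ≠ 0 := by
    rintro rfl
    exact haa rfl
  obtain ⟨x, ⟨hxi, hx⟩, y, ⟨hyi, hy⟩, hxyH, hxy0⟩ := E.ax1 i α hα0 hi
  have hy0 : y ≠ 0 := by
    rintro rfl
    exact hxy0 (map_zero _)
  have hh := E.bracket_eq_form_smul hy hxyH hyi hrα
  set t : E.H := ⟨E.bracket x y, hxyH⟩ with ht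
  set c := E.form x y
  have hc : c ≠ 0 := by
    intro hc
    rw [hc, zero_smul] at hh
    exact hxy0 (congrArg Subtype.val hh)
  have hαt : α t = c * α tα := by simp [hh]
  have hβt : β t = c * β tα := by simp [hh]
  have hne := E.ax2 α hα tα hrα (by rwa [hrα]) x hx
  have hnf := E.ax2 (-α) ((Submodule.ne_bot_iff _).2 ⟨y, hy, hy0⟩) (-tα)
    (by simp [hrα]) (by simpa [hrα] using haa) y hy
  obtain ⟨v, hv, hv0⟩ := (Submodule.ne_bot_iff _).1 hβ
  have hvt := (E.wt_def β v).1 hv t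
  have he := E.bracket_bracket_of_mem_wt hxi hx t
  have hf := E.bracket_bracket_of_mem_wt hyi hy t
  have hjac := E.super_jacobi i i x hxi y hyi
  obtain rfl | rfl := (by decide : ∀ i : ZMod 2, i = 0 ∨ i = 1) i
  · obtain ⟨n, hn⟩ := exists_int_of_commutator (e := E.bracket x) (f := E.bracket y)
      (h := E.bracket t) (a := α t) (fun u => by simp [ht, hjac]) he hf hne hnf hv0 hvt
    refine ⟨n, mul_left_cancel₀ hc ?_⟩
    rw [hαt, hβt] at hn
    linear_combination hn
  · obtain ⟨n, hn⟩ := exists_int_of_anticommutator (e := E.bracket x) (f := E.bracket y)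
      (h := E.bracket t) (a := α t) (hαt ▸ mul_ne_zero hc haa)
      (fun u => by simp [ht, hjac, ZMod.val_one]) he hf hne hnf hv0 hvt
    refine ⟨2 * n, mul_left_cancel₀ hc ?_⟩
    rw [hαt, hβt] at hn
    push_cast
    linear_combination 2 * hn

end EALS

/-- for roots `α, β` with `(α,α) ≠ 0`, `2(β,α)/(α,α)` is an integer; in
particular if `kα` is a root then `k ∈ {0, ±1, ±2, ±1/2}`. -/
theorem EALS_integrality
    {F : Type} [Field F] [CharZero F] {L : Type} [AddCommGroup L] [Module F L]
    (E : EALS F L) (α β : Module.Dual F ↥E.H)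
    (hα : E.wt α ≠ ⊥) (hβ : E.wt β ≠ ⊥)
    (tα tβ : ↥E.H)
    (hrα : ∀ s : ↥E.H, E.form ↑tα ↑s = α s) (hrβ : ∀ s : ↥E.H, E.form ↑tβ ↑s = β s)
    (haa : E.form ↑tα ↑tα ≠ 0) :
    (∃ n : ℤ, 2 * E.form ↑tβ ↑tα = (n : F) * E.form ↑tα ↑tα) ∧
    (∀ k : F, E.wt (k • α) ≠ ⊥ →
        k ∈ ({0, 1, -1, 2, -2, 1/2, -1/2} : Set F)) := by
  rw [hrα] at haa
  refine ⟨?_, fun k hk => ?_⟩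
  · rw [hrα, hrβ]
    exact E.exists_int_two_mul_apply hα hβ hrα haa
  obtain rfl | hk0 := eq_or_ne k 0
  · simp
  obtain ⟨n, hn⟩ := E.exists_int_two_mul_apply hα hk hrα haa
  obtain ⟨m, hm⟩ := E.exists_int_two_mul_apply hk hα (tα := k • tα) (by simp [hrα])
    (by simp [hk0, haa])
  simp only [LinearMap.smul_apply, map_smul, smul_eq_mul] at hn hm
  have hnk : 2 * k = n := mul_right_cancel₀ haa (by linear_combination hn)
  have hmk : 2 = m * k :=
    mul_right_cancel₀ (mul_ne_zero hk0 haa) (by linear_combination hm)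
  have hnm : n * m = 4 := by
    have h1 : (n : F) * m = 4 := by linear_combination -(m : F) * hnk - 2 * hmk
    exact_mod_cast h1
  have hkn : k = n / 2 := by
    rw [eq_div_iff two_ne_zero, mul_comm, hnk]
  have hn4 : n ∣ 4 := ⟨m, hnm.symm⟩
  have hn_le : n ≤ 4 := Int.le_of_dvd (by norm_num) hn4
  have hn_ge : -4 ≤ n := neg_le.1 (Int.le_of_dvd (by norm_num) (neg_dvd.2 hn4))
  subst hkn
  interval_cases n <;> first | (exfalso; lia) | norm_num
end

section
/- Let (L, h, (·,·)) be an extended affine Lie superalgebra over a field F of characteristic zero with root system R. For all α, β ∈ R with (α,α) ≠ 0, the reflected element r_α(β) := β - (2(α,β)/(α,α))·α belongs to R. -/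
section Operators

variable {F V : Type*} [Field F] [AddCommGroup V] [Module F V]

/-- Iterating an operator that shifts the eigenvalues of `T` by `b`. -/
theorem apply_pow_of_shift_s14 {T Y : Module.End F V} {b r : F} {w : V}
    (hTY : ∀ z, T (Y z) = Y (T z) + b • Y z) (hTw : T w = r • w) (n : ℕ) :
    T ((Y ^ n) w) = (r + n * b) • (Y ^ n) w := by
  induction n with
  | zero => simp [hTw]
  | succ n ih =>
    rw [pow_succ', Module.End.mul_apply, hTY, ih, map_smul]
    push_cast
    module

/-- A nonzero vector on which `Y` is nilpotent has a last nonvanishing iterate. -/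
theorem exists_last_pow_ne_zero {Y : Module.End F V} {w : V} (hw : w ≠ 0)
    (hY : ∃ n : ℕ, (Y ^ n) w = 0) :
    ∃ N : ℕ, (Y ^ (N + 1)) w = 0 ∧ ∀ j ≤ N, (Y ^ j) w ≠ 0 := by
  classical
  obtain ⟨N, hN⟩ : ∃ N, Nat.find hY = N + 1 := by
    refine Nat.exists_eq_succ_of_ne_zero fun h => hw ?_
    simpa [h] using Nat.find_spec hY
  exact ⟨N, hN ▸ Nat.find_spec hY, fun j hj => Nat.find_min hY (by omega)⟩

/-- The coefficient `c n` in `X (Y ^ n) w = c n • (Y ^ (n - 1)) w` for a highest weight vector. -/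
def ladderCoeff (s a l : F) : ℕ → F
  | 0 => 0
  | n + 1 => l - n * a + s * ladderCoeff s a l n

theorem ladderCoeff_succ (s a l : F) (n : ℕ) :
    ladderCoeff s a l (n + 1) = l - n * a + s * ladderCoeff s a l n := rfl

theorem ladderCoeff_one (a l : F) (n : ℕ) :
    2 * ladderCoeff 1 a l n = n * (2 * l - (n - 1) * a) := by
  induction n with
  | zero => simp [ladderCoeff]
  | succ n ih =>
    rw [ladderCoeff_succ]
    push_cast
    linear_combination ih

theorem ladderCoeff_neg_one (a l : F) (n : ℕ) :
    ladderCoeff (-1) a l (2 * n) = -(n * a) ∧ ladderCoeff (-1) a l (2 * n + 1) = l - n * a := by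
  induction n with
  | zero => simp [ladderCoeff]
  | succ n ih =>
    have h : ladderCoeff (-1) a l (2 * (n + 1)) = -((n + 1 : ℕ) * a) := by
      rw [show 2 * (n + 1) = 2 * n + 1 + 1 by ring, ladderCoeff_succ, ih.2]
      push_cast
      ring
    refine ⟨h, ?_⟩
    rw [ladderCoeff_succ, h]
    push_cast
    ring

theorem two_mul_eq_of_ladderCoeff_eq_zero [CharZero F] {s a l : F} (hs : s = 1 ∨ s = -1)
    (ha : a ≠ 0) {N : ℕ} (h : ladderCoeff s a l (N + 1) = 0) : 2 * l = N * a := by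
  rcases hs with rfl | rfl
  · have h2 := ladderCoeff_one a l (N + 1)
    rw [h, mul_zero, eq_comm, mul_eq_zero] at h2
    rcases h2 with h2 | h2
    · exact absurd h2 (Nat.cast_ne_zero.2 N.succ_ne_zero)
    · push_cast at h2
      linear_combination h2
  · obtain ⟨n, rfl | rfl⟩ := N.even_or_odd'
    · rw [(ladderCoeff_neg_one a l n).2] at h
      push_cast
      linear_combination 2 * h
    · rw [show 2 * n + 1 + 1 = 2 * (n + 1) by ring, (ladderCoeff_neg_one a l (n + 1)).1,
        neg_eq_zero, mul_eq_zero] at h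
      exact (h.elim (Nat.cast_ne_zero.2 n.succ_ne_zero) ha).elim

/-- Common part of the highest weight theory of `sl₂` (`s = 1`) and `osp(1,2)` (`s = -1`):
a weight vector `v` killed by powers of `X` and `Y` generates a full string. -/
theorem exists_string [CharZero F] {X Y T : Module.End F V} {s a r : F} {v : V}
    (hs : s = 1 ∨ s = -1) (ha : a ≠ 0) (hv : v ≠ 0)
    (hXY : ∀ z, X (Y z) = T z + s • Y (X z))
    (hTX : ∀ z, T (X z) = X (T z) + a • X z)
    (hTY : ∀ z, T (Y z) = Y (T z) + (-a) • Y z)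
    (hX : ∀ z, ∃ n : ℕ, (X ^ n) z = 0) (hY : ∀ z, ∃ n : ℕ, (Y ^ n) z = 0)
    (hTv : T v = r • v) :
    ∃ k N : ℕ, 2 * r = ((N : F) - 2 * k) * a ∧ ∀ j ≤ N, (Y ^ j) ((X ^ k) v) ≠ 0 := by
  obtain ⟨k, hk, hk'⟩ := exists_last_pow_ne_zero hv (hX v)
  have hw := hk' k le_rfl
  have hTw := apply_pow_of_shift_s14 hTX hTv k
  rw [pow_succ', Module.End.mul_apply] at hk
  set w := (X ^ k) v
  obtain ⟨N, hN, hN'⟩ := exists_last_pow_ne_zero hw (hY w)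
  have key : ∀ n : ℕ, X ((Y ^ (n + 1)) w) = ladderCoeff s a (r + k * a) (n + 1) • (Y ^ n) w := by
    intro n
    induction n with
    | zero => simp [ladderCoeff, hXY, hk, hTw]
    | succ n ih =>
      rw [pow_succ' Y (n + 1), Module.End.mul_apply, hXY, ih, map_smul, ← Module.End.mul_apply Y,
        ← pow_succ', apply_pow_of_shift_s14 hTY hTw,
        ladderCoeff_succ s a _ (n + 1)]
      push_cast
      module
  have h0 := key N
  rw [hN, map_zero, eq_comm, smul_eq_zero, or_iff_left (hN' N le_rfl)] at h0
  have h1 := two_mul_eq_of_ladderCoeff_eq_zero hs ha h0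
  exact ⟨k, N, by linear_combination h1, hN'⟩

/-- The weight `r` is a half-integral multiple of `a`, and the string reaches the opposite
weight from one of its two ends. -/
theorem exists_opposite_weight [CharZero F] {X Y T : Module.End F V} {s a r : F} {v : V}
    (hs : s = 1 ∨ s = -1) (ha : a ≠ 0) (hv : v ≠ 0)
    (hXY : ∀ z, X (Y z) = T z + s • Y (X z))
    (hTX : ∀ z, T (X z) = X (T z) + a • X z)
    (hTY : ∀ z, T (Y z) = Y (T z) + (-a) • Y z)
    (hX : ∀ z, ∃ n : ℕ, (X ^ n) z = 0) (hY : ∀ z, ∃ n : ℕ, (Y ^ n) z = 0)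
    (hTv : T v = r • v) :
    ∃ p q : ℕ, 2 * r = ((q : F) - p) * a ∧
      ((Y ^ q) ((X ^ p) v) ≠ 0 ∨ (X ^ p) ((Y ^ q) v) ≠ 0) := by
  have hss : s * s = 1 := by rcases hs with rfl | rfl <;> simp
  have hs0 : s ≠ 0 := by rcases hs with rfl | rfl <;> simp
  obtain ⟨k, N, hkN, hne⟩ := exists_string hs ha hv hXY hTX hTY hX hY hTv
  obtain ⟨k', N', hkN', hne'⟩ := exists_string (X := Y) (Y := X) (T := (-s) • T) (s := s)
    (a := s * a) (r := -s * r) hs (mul_ne_zero hs0 ha) hv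
    (fun z => by
      rw [hXY, LinearMap.smul_apply, smul_add, smul_smul, hss]; module)
    (fun z => by
      simp only [LinearMap.smul_apply, hTY, map_smul]; module)
    (fun z => by
      simp only [LinearMap.smul_apply, hTX, map_smul]; module)
    hY hX (by rw [LinearMap.smul_apply, hTv, smul_smul])
  have h1 : (N : F) - 2 * k + (N' - 2 * k') = 0 := by
    refine (mul_eq_zero.1 (?_ : _ * (s * a) = 0)).resolve_right (mul_ne_zero hs0 ha)
    linear_combination (-s) * hkN - hkN'
  have h2 : (N : ℤ) + N' = 2 * k + 2 * k' := by
    have : ((N + N' : ℕ) : F) = ((2 * k + 2 * k' : ℕ) : F) := by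
      push_cast
      linear_combination h1
    exact_mod_cast Nat.cast_injective this
  rcases le_total (2 * k) N with h | h
  · refine ⟨k, N - k, ?_, Or.inl (hne _ (Nat.sub_le _ _))⟩
    rw [Nat.cast_sub (by omega)]
    linear_combination hkN
  · refine ⟨N' - k', k', ?_, Or.inr (hne' _ (Nat.sub_le _ _))⟩
    rw [Nat.cast_sub (by omega)]
    linear_combination hkN + a * h1

end Operators

section SuperToral

variable {F : Type} [Field F] {L : Type} [AddCommGroup L] [Module F L]

/-- The parity-zero case of the super Jacobi identity, in derivation form. -/
theorem LieSuperAlgebra.even_bracket_bracket (A : LieSuperAlgebra F L) {i : ZMod 2} {t x : L}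
    (ht : t ∈ A.carrier 0) (hx : x ∈ A.carrier i) (z : L) :
    A.bracket t (A.bracket x z) = A.bracket x (A.bracket t z) + A.bracket (A.bracket t x) z := by
  rw [A.super_jacobi 0 i t ht x hx z]
  simp

theorem SuperToral.form_comm_of_even (S : SuperToral F L) {x y : L}
    (hx : x ∈ S.carrier 0) (hy : y ∈ S.carrier 0) : S.form x y = S.form y x := by
  simpa using S.form_super 0 0 x hx y hy

theorem SuperToral.bracket_pow_mem_wt (S : SuperToral F L) {i : ZMod 2}
    {α β : Module.Dual F S.H} {x v : L} (hxi : x ∈ S.carrier i) (hx : x ∈ S.wt α)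
    (hv : v ∈ S.wt β) (n : ℕ) :
    (S.bracket x ^ n) v ∈ S.wt (β + (n : F) • α) := by
  rw [S.wt_def] at hx hv ⊢
  intro t
  refine (apply_pow_of_shift_s14 (T := S.bracket t) (b := α t) (fun z => ?_) (hv t) n).trans ?_
  · rw [S.even_bracket_bracket (S.H_le t.2) hxi, hx t, map_smul, LinearMap.smul_apply]
  · simp

theorem SuperToral.exists_homogeneous_wt_ne_bot (S : SuperToral F L)
    {α : Module.Dual F S.H} (hα : S.wt α ≠ ⊥) : ∃ i, S.carrier i ⊓ S.wt α ≠ ⊥ := by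
  obtain ⟨u, hu, hu0⟩ := Submodule.exists_mem_ne_zero_of_ne_bot hα
  obtain ⟨x, hx, y, hy, rfl⟩ := Submodule.mem_sup.1
    ((S.isCompl.sup_eq_top ▸ Submodule.mem_top : u ∈ S.carrier 0 ⊔ S.carrier 1))
  rw [S.wt_def] at hu
  have hz (t : S.H) : S.bracket t x - α t • x = 0 := by
    have h0 : S.bracket t x - α t • x ∈ S.carrier 0 :=
      sub_mem (by simpa using S.bracket_mem 0 0 t (S.H_le t.2) x hx) (Submodule.smul_mem _ _ hx)
    have h1 : S.bracket t y - α t • y ∈ S.carrier 1 :=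
      sub_mem (by simpa using S.bracket_mem 0 1 t (S.H_le t.2) y hy) (Submodule.smul_mem _ _ hy)
    refine Submodule.disjoint_def.1 S.isCompl.disjoint _ h0 ?_
    have h2 : S.bracket t x - α t • x = -(S.bracket t y - α t • y) := by
      have := hu t
      rw [map_add, smul_add] at this
      rw [neg_sub, sub_eq_sub_iff_add_eq_add, this, add_comm]
    exact h2 ▸ neg_mem h1
  have hxα : x ∈ S.wt α := (S.wt_def _ _).2 fun t => sub_eq_zero.1 (hz t)
  by_cases hx0 : x = 0
  · subst hx0
    rw [zero_add] at hu0 hu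
    exact ⟨1, Submodule.ne_bot_iff _ |>.2 ⟨y, ⟨hy, (S.wt_def _ _).2 hu⟩, hu0⟩⟩
  · exact ⟨0, Submodule.ne_bot_iff _ |>.2 ⟨x, ⟨hx, hxα⟩, hx0⟩⟩

/-- Brackets of opposite root vectors that land in `H` are multiples of `t_α`. -/
theorem SuperToral.bracket_eq_smul (S : SuperToral F L) {α : Module.Dual F S.H} {tα : S.H}
    (hrα : ∀ s : S.H, S.form tα s = α s) {x y : L} (hx : x ∈ S.wt α)
    (hxy : S.bracket x y ∈ S.H) : S.bracket x y = S.form x y • (tα : L) := by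
  have h := S.form_H_nondeg (⟨S.bracket x y, hxy⟩ - S.form x y • tα) fun s => by
    have h1 : S.form (S.bracket x y) s = α s * S.form x y := by
      rw [S.form_comm_of_even (S.H_le hxy) (S.H_le s.2), ← S.form_inv, (S.wt_def _ _).1 hx s]
      simp
    simp [h1, hrα, mul_comm]
  simpa using congrArg Subtype.val (sub_eq_zero.1 h)

end SuperToral

/-- for roots `α, β` with `(α,α) ≠ 0`, the reflection
`r_α(β) = β - (2(α,β)/(α,α))·α` is again a root. -/
theorem EALS_reflection
    {F : Type} [Field F] [CharZero F] {L : Type} [AddCommGroup L] [Module F L]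
    (E : EALS F L) (α β : Module.Dual F ↥E.H)
    (hα : E.wt α ≠ ⊥) (hβ : E.wt β ≠ ⊥)
    (tα tβ : ↥E.H)
    (hrα : ∀ s : ↥E.H, E.form ↑tα ↑s = α s) (hrβ : ∀ s : ↥E.H, E.form ↑tβ ↑s = β s)
    (haa : E.form ↑tα ↑tα ≠ 0) :
    E.wt (β - (2 * E.form ↑tα ↑tβ / E.form ↑tα ↑tα) • α) ≠ ⊥ := by
  have hα0 : α ≠ 0 := fun h => haa (by rw [hrα, h, LinearMap.zero_apply])
  obtain ⟨i, hi⟩ := E.exists_homogeneous_wt_ne_bot hα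
  obtain ⟨x, ⟨hxi, hx⟩, y, ⟨hyi, hy⟩, hH, hne⟩ := E.ax1 i α hα0 hi
  obtain ⟨v, hv, hv0⟩ := Submodule.exists_mem_ne_zero_of_ne_bot hβ
  have hxy := E.bracket_eq_smul hrα hx hH
  set c := E.form x y
  have hc : c ≠ 0 := fun h => hne (by rw [hxy, h, zero_smul])
  have hy0 : y ≠ 0 := fun h => hne (by rw [h, map_zero])
  have hX := E.ax2 α hα tα hrα haa x hx
  have hY := E.ax2 (-α) (Submodule.ne_bot_iff _ |>.2 ⟨y, hy, hy0⟩) (-tα)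
    (fun s => by simp [hrα]) (by simpa using haa) y hy
  have hβα : E.form tα tβ = β tα := by
    rw [← hrβ, E.form_comm_of_even (E.H_le tα.2) (E.H_le tβ.2)]
  have hαt : E.form tα tα = α tα := hrα tα
  obtain ⟨p, q, hpq, hpow⟩ := exists_opposite_weight (X := E.bracket x) (Y := E.bracket y)
    (T := c • E.bracket tα) (s := (-1) ^ (i.val * i.val)) (a := c * α tα) (r := c * β tα)
    (neg_one_pow_eq_or F _) (mul_ne_zero hc (hαt ▸ haa)) hv0
    (fun z => by
      rw [← LinearMap.map_smul, ← hxy, E.super_jacobi i i x hxi y hyi, sub_add_cancel])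
    (fun z => by
      simp only [LinearMap.smul_apply, E.even_bracket_bracket (E.H_le tα.2) hxi,
        (E.wt_def _ _).1 hx, map_smul, smul_add, smul_smul])
    (fun z => by
      simp only [LinearMap.smul_apply, E.even_bracket_bracket (E.H_le tα.2) hyi,
        (E.wt_def _ _).1 hy, map_smul, smul_add, smul_smul, LinearMap.neg_apply, mul_neg])
    hX hY (by rw [LinearMap.smul_apply, (E.wt_def _ _).1 hv, smul_smul])
  have hm : 2 * E.form tα tβ / E.form tα tα = (q : F) - p := by
    rw [div_eq_iff haa, hβα, hαt]
    exact mul_left_cancel₀ hc (by linear_combination hpq)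
  rw [hm, Submodule.ne_bot_iff]
  rcases hpow with h | h
  · refine ⟨_, ?_, h⟩
    convert E.bracket_pow_mem_wt hyi hy (E.bracket_pow_mem_wt hxi hx hv p) q using 2
    module
  · refine ⟨_, ?_, h⟩
    convert E.bracket_pow_mem_wt hxi hx (E.bracket_pow_mem_wt hyi hy hv q) p using 2
    module
end

section
/- Let (L, h, (·,·)) be an extended affine Lie superalgebra over a field F of characteristic zero with root system R. For all α, β ∈ R with (α,α) ≠ 0, there exist nonnegative integers p and q such that 2(β,α)/(α,α) = (p - q)·1_F and {k ∈ ℤ : β + kα ∈ R} = {-p, -p+1, …, q-1, q}. -/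
theorem abs_le_of_quadratic_eq {C D d m n k : ℤ} (hD : D ≠ 0) (hn : n ≠ 0) (hd : |d| ≤ 1)
    (h : d * (m + 2 * k) * D = n * (C + D * (k * m + k ^ 2))) : |k| ≤ |C| + 2 * |m| + 2 := by
  have hn1 : 1 ≤ |n| := Int.one_le_abs hn
  have hD1 : 1 ≤ |D| := Int.one_le_abs hD
  have h1 : |C + D * (k * m + k ^ 2)| ≤ |m + 2 * k| * |D| := by
    have h2 : |d| * |m + 2 * k| * |D| = |n| * |C + D * (k * m + k ^ 2)| := by
      rw [← abs_mul, ← abs_mul, ← abs_mul, h]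
    have h3 : |d| * (|m + 2 * k| * |D|) ≤ 1 * (|m + 2 * k| * |D|) := by gcongr
    have h4 : 1 * |C + D * (k * m + k ^ 2)| ≤ |n| * |C + D * (k * m + k ^ 2)| := by gcongr
    linarith
  have h2 : |D| * |k * m + k ^ 2| ≤ |C| + |m + 2 * k| * |D| := by
    rw [← abs_mul]
    have := abs_sub (C + D * (k * m + k ^ 2)) C
    rw [add_sub_cancel_left] at this
    linarith
  have h3 : |k| ^ 2 ≤ |k * m + k ^ 2| + |k| * |m| := by
    have := abs_sub (k * m + k ^ 2) (k * m)
    rwa [add_sub_cancel_left, abs_pow, abs_mul k m] at this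
  have h4 : |m + 2 * k| ≤ |m| + 2 * |k| := by
    have := abs_add_le m (2 * k)
    rwa [abs_mul, abs_two] at this
  have h5 : |k * m + k ^ 2| ≤ |C| + |m + 2 * k| := by
    have hC : |C| ≤ |D| * |C| := le_mul_of_one_le_left (abs_nonneg C) hD1
    exact le_of_mul_le_mul_left (by linarith) (by linarith : 0 < |D|)
  have hC := abs_nonneg C
  have hm := abs_nonneg m
  have hk := abs_nonneg k
  by_contra! hlt
  nlinarith

section Operators

variable {F V : Type*} [Field F] [AddCommGroup V] [Module F V]

theorem exists_pow_ne_zero_and_pow_succ_eq_zero {E : Module.End F V}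
    {v : V} (hv : v ≠ 0) (hE : ∃ n : ℕ, (E ^ n) v = 0) :
    ∃ r : ℕ, (∀ i ≤ r, (E ^ i) v ≠ 0) ∧ (E ^ (r + 1)) v = 0 := by
  classical
  have h0 : Nat.find hE ≠ 0 := fun h => hv (by simpa [h] using Nat.find_spec hE)
  obtain ⟨r, hr⟩ := Nat.exists_eq_succ_of_ne_zero h0
  exact ⟨r, fun i hi => Nat.find_min hE (by omega), by simpa [hr] using Nat.find_spec hE⟩

theorem weight_pow_apply {A T : Module.End F V} {a c : F} (h : T * A - A * T = a • A)
    {v : V} (hv : T v = c • v) (n : ℕ) : T ((A ^ n) v) = (c + n * a) • (A ^ n) v := by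
  induction n with
  | zero => simpa using hv
  | succ n ih =>
    have := LinearMap.congr_fun h ((A ^ n) v)
    simp only [LinearMap.sub_apply, Module.End.mul_apply, LinearMap.smul_apply, ih,
      map_smul] at this
    rw [pow_succ', Module.End.mul_apply, sub_eq_iff_eq_add.mp this]
    push_cast
    module

/-- Weights of an integrable `sl₂`-action are integral, and the vector of highest weight reached
from a weight vector generates an unbroken string. -/
theorem exists_string_of_sl2 [CharZero F] {E A T : Module.End F V} {a c : F}
    (hEA : E * A - A * E = T) (hTE : T * E - E * T = a • E) (hTA : T * A - A * T = (-a) • A)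
    (hE : ∀ v, ∃ n : ℕ, (E ^ n) v = 0) (hA : ∀ v, ∃ n : ℕ, (A ^ n) v = 0)
    {v : V} (hv : v ≠ 0) (hTv : T v = c • v) :
    ∃ s r : ℕ, 2 * c = ((s : F) - 2 * r) * a ∧ ∀ i ≤ s, (A ^ i) ((E ^ r) v) ≠ 0 := by
  obtain ⟨r, hr, hr1⟩ := exists_pow_ne_zero_and_pow_succ_eq_zero hv (hE v)
  have hTw := weight_pow_apply hTE hTv r
  set w := (E ^ r) v with hw
  have hEw : E w = 0 := by rwa [hw, ← Module.End.mul_apply, ← pow_succ']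
  obtain ⟨s, hs, hs1⟩ := exists_pow_ne_zero_and_pow_succ_eq_zero (hr r le_rfl) (hA w)
  refine ⟨s, r, ?_, hs⟩
  have key : ∀ j : ℕ, (2 : F) • E ((A ^ (j + 1)) w) =
      ((j + 1) * (2 * (c + r * a) - j * a)) • (A ^ j) w := by
    intro j
    have comm : ∀ u, E (A u) = A (E u) + T u := fun u => by rw [← hEA]; simp
    induction j with
    | zero => simp [comm, hEw, hTw, smul_smul]
    | succ j ih =>
      rw [pow_succ', Module.End.mul_apply, comm, smul_add, ← map_smul, ih,
        weight_pow_apply hTA hTw, map_smul, ← Module.End.mul_apply, ← pow_succ']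
      push_cast
      module
  have h := key s
  rw [hs1, map_zero, smul_zero, eq_comm, smul_eq_zero, or_iff_left (hs s le_rfl),
    mul_eq_zero, or_iff_right (Nat.cast_add_one_ne_zero s)] at h
  linear_combination h

/-- The analogue of `exists_string_of_sl2` for an integrable `osp(1,2)`-action. -/
theorem exists_string_of_osp [CharZero F] {E A T : Module.End F V} {a c : F} (ha : a ≠ 0)
    (hEA : E * A + A * E = T) (hTE : T * E - E * T = a • E) (hTA : T * A - A * T = (-a) • A)
    (hE : ∀ v, ∃ n : ℕ, (E ^ n) v = 0) (hA : ∀ v, ∃ n : ℕ, (A ^ n) v = 0)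
    {v : V} (hv : v ≠ 0) (hTv : T v = c • v) :
    ∃ s r : ℕ, 2 * c = ((s : F) - 2 * r) * a ∧ ∀ i ≤ s, (A ^ i) ((E ^ r) v) ≠ 0 := by
  have sq_nilp : ∀ {B : Module.End F V}, (∀ v, ∃ n : ℕ, (B ^ n) v = 0) →
      ∀ v, ∃ n : ℕ, ((B ^ 2) ^ n) v = 0 := by
    intro B hB v
    obtain ⟨n, hn⟩ := hB v
    refine ⟨n, ?_⟩
    rw [← pow_mul, two_mul, pow_add, Module.End.mul_apply, hn, map_zero]
  have hTE' : T * E = E * T + a • E := by rw [← hTE]; abel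
  have h1 : E ^ 2 * A ^ 2 - A ^ 2 * E ^ 2 = (-a) • T := by
    have hsq : E ^ 2 * A - A * E ^ 2 = (-a) • E := by
      calc E ^ 2 * A - A * E ^ 2 = E * (E * A + A * E) - (E * A + A * E) * E := by noncomm_ring
        _ = (-a) • E := by rw [hEA, hTE']; module
    calc E ^ 2 * A ^ 2 - A ^ 2 * E ^ 2
        = (E ^ 2 * A - A * E ^ 2) * A + A * (E ^ 2 * A - A * E ^ 2) := by noncomm_ring
      _ = (-a) • (E * A + A * E) := by rw [hsq, smul_mul_assoc, mul_smul_comm, smul_add]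
      _ = (-a) • T := by rw [hEA]
  have h2 : T * E ^ 2 - E ^ 2 * T = (2 * a) • E ^ 2 := by
    calc T * E ^ 2 - E ^ 2 * T = (T * E - E * T) * E + E * (T * E - E * T) := by noncomm_ring
      _ = _ := by rw [hTE, smul_mul_assoc, mul_smul_comm, ← sq E]; module
  have h3 : T * A ^ 2 - A ^ 2 * T = (2 * -a) • A ^ 2 := by
    calc T * A ^ 2 - A ^ 2 * T = (T * A - A * T) * A + A * (T * A - A * T) := by noncomm_ring
      _ = _ := by rw [hTA, smul_mul_assoc, mul_smul_comm, ← sq A]; module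
  obtain ⟨s, r, hc, hs⟩ := exists_string_of_sl2 (a := -a * (2 * a)) (c := -a * c)
    h1
    (by rw [smul_mul_assoc, mul_smul_comm, ← smul_sub, h2, smul_smul])
    (by rw [smul_mul_assoc, mul_smul_comm, ← smul_sub, h3, smul_smul]; congr 1; ring)
    (sq_nilp hE) (sq_nilp hA) hv (by rw [LinearMap.smul_apply, hTv, smul_smul])
  refine ⟨2 * s, 2 * r, ?_, fun i hi h => hs s le_rfl ?_⟩
  · apply mul_left_cancel₀ (neg_ne_zero.mpr ha)
    push_cast
    linear_combination hc
  · rw [← pow_mul, ← pow_mul, ← Nat.sub_add_cancel hi, pow_add, Module.End.mul_apply, h, map_zero]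

end Operators

namespace EALS

variable {F : Type} [Field F] {L : Type} [AddCommGroup L] [Module F L] (E : EALS F L)

theorem form_comm_of_mem_H (s t : ↥E.H) : E.form ↑s ↑t = E.form ↑t ↑s := by
  simpa using E.form_super 0 0 s (E.H_le s.2) t (E.H_le t.2)

theorem bracket_mem_wt {α γ : Module.Dual F ↥E.H} {x y : L} (hx : x ∈ E.wt α)
    (hy : y ∈ E.wt γ) {i : ZMod 2} (hxi : x ∈ E.carrier i) : E.bracket x y ∈ E.wt (α + γ) := by
  rw [E.wt_def] at hx hy ⊢
  intro t
  have h := E.super_jacobi 0 i t (E.H_le t.2) x hxi y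
  rw [hx, hy] at h
  simp only [map_smul, LinearMap.smul_apply, ZMod.val_zero, zero_mul, pow_zero, one_smul] at h
  rw [eq_sub_iff_add_eq] at h
  rw [← h, LinearMap.add_apply, add_smul]

theorem bracket_pow_mem_wt {α γ : Module.Dual F ↥E.H} {x y : L} (hx : x ∈ E.wt α)
    (hy : y ∈ E.wt γ) {i : ZMod 2} (hxi : x ∈ E.carrier i) (n : ℕ) :
    ((E.bracket x) ^ n) y ∈ E.wt (γ + n • α) := by
  induction n with
  | zero => simpa using hy
  | succ n ih =>
    rw [pow_succ', Module.End.mul_apply, show γ + (n + 1) • α = α + (γ + n • α) by module]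
    exact E.bracket_mem_wt hx ih hxi

theorem exists_carrier_inf_wt_ne_bot {α : Module.Dual F ↥E.H} (hα : E.wt α ≠ ⊥) :
    ∃ i : ZMod 2, E.carrier i ⊓ E.wt α ≠ ⊥ := by
  obtain ⟨x, hx, hx0⟩ := Submodule.exists_mem_ne_zero_of_ne_bot hα
  obtain ⟨x₀, hx₀, x₁, hx₁, rfl⟩ := Submodule.mem_sup.mp
    (E.isCompl.sup_eq_top ▸ Submodule.mem_top : x ∈ E.carrier 0 ⊔ E.carrier 1)
  rw [E.wt_def] at hx
  have key : ∀ t : ↥E.H, E.bracket t x₀ = α t • x₀ ∧ E.bracket t x₁ = α t • x₁ := by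
    intro t
    have h := hx t
    have m0 := E.bracket_mem 0 0 t (E.H_le t.2) x₀ hx₀
    have m1 := E.bracket_mem 0 1 t (E.H_le t.2) x₁ hx₁
    rw [add_zero] at m0
    rw [zero_add] at m1
    rw [map_add, smul_add] at h
    have e : E.bracket t x₀ - α t • x₀ = α t • x₁ - E.bracket t x₁ := by
      rw [sub_eq_sub_iff_add_eq_add, h, add_comm]
    have z := Submodule.disjoint_def.mp E.isCompl.disjoint _
      (Submodule.sub_mem _ m0 (Submodule.smul_mem _ _ hx₀))
      (e ▸ Submodule.sub_mem _ (Submodule.smul_mem _ _ hx₁) m1)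
    exact ⟨sub_eq_zero.mp z, (sub_eq_zero.mp (e ▸ z)).symm⟩
  by_cases h0 : x₀ = 0
  · refine ⟨1, fun hb => hx0 ?_⟩
    have : x₁ ∈ E.carrier 1 ⊓ E.wt α := ⟨hx₁, (E.wt_def _ _).mpr fun t => (key t).2⟩
    rw [hb, Submodule.mem_bot] at this
    rw [h0, this, add_zero]
  · refine ⟨0, fun hb => h0 ?_⟩
    have : x₀ ∈ E.carrier 0 ⊓ E.wt α := ⟨hx₀, (E.wt_def _ _).mpr fun t => (key t).1⟩
    rwa [hb, Submodule.mem_bot] at this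

theorem exists_bracket_eq (α : Module.Dual F ↥E.H) (hα : E.wt α ≠ ⊥)
    (tα : ↥E.H) (hrα : ∀ s : ↥E.H, E.form ↑tα ↑s = α s) (haa : E.form ↑tα ↑tα ≠ 0) :
    ∃ i : ZMod 2, ∃ x ∈ E.carrier i ⊓ E.wt α, ∃ y ∈ E.carrier i ⊓ E.wt (-α),
      E.bracket x y = tα := by
  have hα0 : α ≠ 0 := fun h => haa (by rw [hrα, h, LinearMap.zero_apply])
  obtain ⟨i, hi⟩ := E.exists_carrier_inf_wt_ne_bot hα
  obtain ⟨x, hx, y, hy, hH, hne⟩ := E.ax1 i α hα0 hi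
  have hxy : E.bracket x y = E.form x y • (tα : L) := by
    have h := E.form_H_nondeg (⟨E.bracket x y, hH⟩ - E.form x y • tα) fun s => by
      have hskew := E.skew i 0 y hy.1 s (E.H_le s.2)
      rw [(E.wt_def _ _).mp hy.2 s] at hskew
      simp [E.form_inv, hskew, hrα, mul_comm]
    simpa [Subtype.ext_iff, sub_eq_zero] using h
  have hf : E.form x y ≠ 0 := fun h => hne (by rw [hxy, h, zero_smul])
  refine ⟨i, x, hx, (E.form x y)⁻¹ • y, Submodule.smul_mem _ _ hy, ?_⟩
  rw [map_smul, hxy, smul_smul, inv_mul_cancel₀ hf, one_smul]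

theorem wt_neg_ne_bot (α : Module.Dual F ↥E.H) (hα : E.wt α ≠ ⊥)
    (tα : ↥E.H) (hrα : ∀ s : ↥E.H, E.form ↑tα ↑s = α s) (haa : E.form ↑tα ↑tα ≠ 0) :
    E.wt (-α) ≠ ⊥ := by
  obtain ⟨i, x, hx, y, hy, hxy⟩ := E.exists_bracket_eq α hα tα hrα haa
  intro hb
  have hy0 : y ∈ E.wt (-α) := hy.2
  rw [hb, Submodule.mem_bot] at hy0
  apply haa
  rw [← hxy, hy0]
  simp

/-- For a nonisotropic root `α` and a root `γ`, the number `n = 2(γ,α)/(α,α)` is an integer, and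
`γ, γ - α, …, γ - nα` are roots. -/
theorem exists_int_root_sub [CharZero F] (α γ : Module.Dual F ↥E.H) (hα : E.wt α ≠ ⊥)
    (hγ : E.wt γ ≠ ⊥) (tα : ↥E.H) (hrα : ∀ s : ↥E.H, E.form ↑tα ↑s = α s)
    (haa : E.form ↑tα ↑tα ≠ 0) :
    ∃ n : ℤ, 2 * γ tα = n * E.form ↑tα ↑tα ∧
      ∀ i : ℕ, (i : ℤ) ≤ n → E.wt (γ - i • α) ≠ ⊥ := by
  obtain ⟨i, x, hx, y, hy, hxy⟩ := E.exists_bracket_eq α hα tα hrα haa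
  obtain ⟨v, hv, hv0⟩ := Submodule.exists_mem_ne_zero_of_ne_bot hγ
  have hT : ∀ {δ : Module.Dual F ↥E.H} {u : L}, u ∈ E.wt δ → u ∈ E.carrier i →
      (E.bracket tα * E.bracket u - E.bracket u * E.bracket tα : Module.End F L) =
        δ tα • E.bracket u := by
    intro δ u hu hui
    ext z
    have h := E.super_jacobi 0 i tα (E.H_le tα.2) u hui z
    rw [(E.wt_def _ _).mp hu] at h
    simpa using h.symm
  have hTE := hT hx.2 hx.1
  have hTA := hT hy.2 hy.1
  rw [LinearMap.neg_apply, ← hrα] at hTA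
  rw [← hrα] at hTE
  have hE : ∀ z, ∃ n : ℕ, ((E.bracket x) ^ n) z = 0 := E.ax2 α hα tα hrα haa x hx.2
  have hA : ∀ z, ∃ n : ℕ, ((E.bracket y) ^ n) z = 0 :=
    E.ax2 (-α) (E.wt_neg_ne_bot α hα tα hrα haa) (-tα) (fun s => by simp [hrα])
      (by simpa using haa) y hy.2
  have hTv : E.bracket tα v = γ tα • v := (E.wt_def _ _).mp hv tα
  have hstring : ∃ s r : ℕ, 2 * γ tα = ((s : F) - 2 * r) * E.form ↑tα ↑tα ∧
      ∀ j ≤ s, ((E.bracket y) ^ j) (((E.bracket x) ^ r) v) ≠ 0 := by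
    have hjac := E.super_jacobi i i x hx.1 y hy.1
    rw [hxy] at hjac
    have hi : i = 0 ∨ i = 1 := by clear * -; revert i; decide
    rcases hi with rfl | rfl
    · refine exists_string_of_sl2 ?_ hTE hTA hE hA hv0 hTv
      ext z
      simpa using (hjac z).symm
    · refine exists_string_of_osp haa ?_ hTE hTA hE hA hv0 hTv
      ext z
      simpa [ZMod.val_one] using (hjac z).symm
  obtain ⟨s, r, hc, hs⟩ := hstring
  refine ⟨s - 2 * r, by push_cast; exact hc, fun j hj hb => hs (r + j) (by omega) ?_⟩
  have hmem := E.bracket_pow_mem_wt hy.2 (E.bracket_pow_mem_wt hx.2 hv hx.1 r) hy.1 (r + j)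
  rwa [show γ + r • α + (r + j) • (-α) = γ - j • α by module, hb, Submodule.mem_bot] at hmem

end EALS

/-- the root string property: for roots `α, β` with `(α,α) ≠ 0` there are
nonnegative integers `p, q` with `2(β,α)/(α,α) = p - q` and
`{k ∈ ℤ : β + kα ∈ R} = {-p, …, q}`. -/
theorem EALS_root_string
    {F : Type} [Field F] [CharZero F] {L : Type} [AddCommGroup L] [Module F L]
    (E : EALS F L) (α β : Module.Dual F ↥E.H)
    (hα : E.wt α ≠ ⊥) (hβ : E.wt β ≠ ⊥)
    (tα tβ : ↥E.H)
    (hrα : ∀ s : ↥E.H, E.form ↑tα ↑s = α s) (hrβ : ∀ s : ↥E.H, E.form ↑tβ ↑s = β s)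
    (haa : E.form ↑tα ↑tα ≠ 0) :
    ∃ p q : ℕ, 2 * E.form ↑tβ ↑tα = ((p : F) - (q : F)) * E.form ↑tα ↑tα ∧
      ∀ k : ℤ, E.wt (β + k • α) ≠ ⊥ ↔ -(p : ℤ) ≤ k ∧ k ≤ (q : ℤ) := by
  classical
  have haα : α tα = E.form ↑tα ↑tα := (hrα tα).symm
  have hsymm := E.form_comm_of_mem_H
  have string : ∀ k : ℤ, E.wt (β + k • α) ≠ ⊥ → ∃ n : ℤ,
      2 * (β + k • α) tα = n * E.form ↑tα ↑tα ∧
      (∀ i : ℕ, (i : ℤ) ≤ n → E.wt (β + (k - i) • α) ≠ ⊥) ∧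
      (∀ i : ℕ, (i : ℤ) ≤ -n → E.wt (β + (k + i) • α) ≠ ⊥) := by
    intro k hk
    obtain ⟨n, hn, h1⟩ := E.exists_int_root_sub α (β + k • α) hα hk tα hrα haa
    obtain ⟨n', hn', h2⟩ := E.exists_int_root_sub (-α) (β + k • α)
      (E.wt_neg_ne_bot α hα tα hrα haa) hk (-tα) (fun s => by simp [hrα]) (by simpa using haa)
    have hnn : n' = -n := by
      have h : ((n' : ℤ) : F) = ((-n : ℤ) : F) := by
        apply mul_right_cancel₀ haa
        push_cast
        simp only [map_neg, Submodule.coe_neg, LinearMap.neg_apply, neg_neg] at hn'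
        linear_combination -hn - hn'
      exact_mod_cast h
    refine ⟨n, hn, fun i hi => ?_, fun i hi => ?_⟩
    · have := h1 i hi
      rwa [show β + (k - i) • α = β + k • α - i • α by module]
    · have := h2 i (hnn ▸ hi)
      rwa [show β + (k + i) • α = β + k • α - i • (-α) by module]
  have hβ0 : E.wt (β + (0 : ℤ) • α) ≠ ⊥ := by simpa using hβ
  obtain ⟨m, hm, -⟩ := string 0 hβ0
  rw [zero_smul, add_zero] at hm
  have reflect : ∀ k : ℤ, E.wt (β + k • α) ≠ ⊥ → ∀ j : ℤ,
      (-m - k ≤ j ∧ j ≤ k ∨ k ≤ j ∧ j ≤ -m - k) → E.wt (β + j • α) ≠ ⊥ := by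
    intro k hk j hj
    obtain ⟨n, hn, h1, h2⟩ := string k hk
    have hnm : n = m + 2 * k := by
      have h : ((n : ℤ) : F) = ((m + 2 * k : ℤ) : F) := by
        apply mul_right_cancel₀ haa
        simp only [LinearMap.add_apply, LinearMap.smul_apply, zsmul_eq_mul, haα] at hn
        push_cast
        linear_combination hm - hn
      exact_mod_cast h
    rcases hj with hj | hj
    · have := h1 (k - j).toNat (by omega)
      rwa [show k - ((k - j).toNat : ℤ) = j by omega] at this
    · have := h2 (j - k).toNat (by omega)
      rwa [show k + ((j - k).toNat : ℤ) = j by omega] at this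
  have hmab : 2 * E.form ↑tβ ↑tα = m * E.form ↑tα ↑tα := by rw [hrβ, hm]
  have dual : ∀ k : ℤ, E.wt (β + k • α) ≠ ⊥ → ∃ d n : ℤ, (n ≠ 0 ∨ m + 2 * k = 0) ∧ |d| ≤ 1 ∧
      d * ((m + 2 * k : ℤ) : F) * E.form ↑tα ↑tα =
        n * (E.form ↑tβ ↑tβ + k * m * E.form ↑tα ↑tα + k ^ 2 * E.form ↑tα ↑tα) := by
    intro k hk
    have hg : E.form ↑(tβ + k • tα) ↑(tβ + k • tα) =
        E.form ↑tβ ↑tβ + k * m * E.form ↑tα ↑tα + k ^ 2 * E.form ↑tα ↑tα := by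
      simp only [Submodule.coe_add, Submodule.coe_smul_of_tower, map_add, map_zsmul,
        LinearMap.add_apply, LinearMap.smul_apply, zsmul_eq_mul, hsymm tα tβ]
      linear_combination (k : F) * hmab
    by_cases h0 : E.form ↑(tβ + k • tα) ↑(tβ + k • tα) = 0
    · exact ⟨0, 1, by simp, by simp, by rw [← hg, h0]; simp⟩
    · obtain ⟨n, hn, -⟩ := E.exists_int_root_sub (β + k • α) α hk hα (tβ + k • tα)
        (fun s => by simp [hrα, hrβ]) h0
      rw [hg, ← hrα, hsymm] at hn
      simp only [Submodule.coe_add, Submodule.coe_smul_of_tower, map_add, map_zsmul,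
        LinearMap.add_apply, LinearMap.smul_apply, zsmul_eq_mul] at hn
      have key : ((1 : ℤ) : F) * ((m + 2 * k : ℤ) : F) * E.form ↑tα ↑tα =
        n * (E.form ↑tβ ↑tβ + k * m * E.form ↑tα ↑tα + k ^ 2 * E.form ↑tα ↑tα) := by
        push_cast
        linear_combination hn - hmab
      refine ⟨1, n, ?_, by simp, key⟩
      by_contra! hc
      obtain ⟨rfl, hc⟩ := hc
      apply hc
      simp only [Int.cast_one, one_mul, Int.cast_zero, zero_mul, mul_eq_zero, haa, or_false] at key
      exact_mod_cast key
  have bounded : ∃ K : ℤ, ∀ k : ℤ, E.wt (β + k • α) ≠ ⊥ → |k| ≤ K := by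
    by_cases hall : ∀ k : ℤ, E.wt (β + k • α) ≠ ⊥ → m + 2 * k = 0
    · exact ⟨|m|, fun k hk => by
        have := hall k hk
        rw [abs_le]
        have := le_abs_self m
        have := neg_abs_le m
        omega⟩
    push Not at hall
    obtain ⟨k₀, hk₀, hne⟩ := hall
    obtain ⟨d, D, hD, -, hd⟩ := dual k₀ hk₀
    replace hD : D ≠ 0 := hD.resolve_right hne
    obtain ⟨C, hC⟩ : ∃ C : ℤ, D * E.form ↑tβ ↑tβ = C * E.form ↑tα ↑tα :=
      ⟨d * (m + 2 * k₀) - D * (k₀ * m + k₀ ^ 2), by push_cast at hd ⊢; linear_combination -hd⟩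
    refine ⟨|C| + 2 * |m| + 2, fun k hk => ?_⟩
    obtain ⟨d', n, hn, hd'1, hd'⟩ := dual k hk
    rcases hn with hn | hn
    · have hZ : d' * (m + 2 * k) * D = n * (C + D * (k * m + k ^ 2)) := by
        have h : ((d' * (m + 2 * k) * D : ℤ) : F) = ((n * (C + D * (k * m + k ^ 2)) : ℤ) : F) := by
          apply mul_right_cancel₀ haa
          push_cast at hd' ⊢
          linear_combination (D : F) * hd' + (n : F) * hC
        exact_mod_cast h
      exact abs_le_of_quadratic_eq hD hn hd'1 hZ
    · have := abs_nonneg C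
      have := le_abs_self m
      have := neg_abs_le m
      rw [abs_le]
      omega
  obtain ⟨K, hK⟩ := bounded
  obtain ⟨M, hM, hMmax⟩ := Int.exists_greatest_of_bdd (P := fun k => E.wt (β + k • α) ≠ ⊥)
    ⟨K, fun k hk => (abs_le.mp (hK k hk)).2⟩ ⟨0, hβ0⟩
  have hM0 := hMmax 0 hβ0
  have hlow : ∀ k : ℤ, E.wt (β + k • α) ≠ ⊥ → -m - M ≤ k := fun k hk => by
    have := hMmax (-m - k) (reflect k hk _ (by omega))
    omega
  have hlow0 := hlow 0 hβ0
  refine ⟨(m + M).toNat, M.toNat, ?_, fun k => ⟨fun hk => ?_, fun hk => ?_⟩⟩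
  · have h : (((m + M).toNat : ℤ) : F) - ((M.toNat : ℤ) : F) = m := by
      rw [Int.toNat_of_nonneg (by omega), Int.toNat_of_nonneg hM0]
      push_cast
      ring
    rw [Int.cast_natCast, Int.cast_natCast] at h
    rw [h, hmab]
  · have := hMmax k hk
    have := hlow k hk
    omega
  · exact reflect M hM k (by omega)
end

section
/- Let (L, h, (·,·)) be an extended affine Lie superalgebra over a field F of characteristic zero with root system R = R₀ ∪ R₁. Then: (a) for every α ∈ R with (α,α) ≠ 0, 2α ∉ R₁; (b) if α ∈ R satisfies (α,α) ≠ 0 and 2α ∉ R, then α ∈ R₀. -/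
namespace Module.End

variable {F M : Type*} [Field F] [AddCommGroup M] [Module F M]

/-- A nonzero vector on which `X` acts locally nilpotently has a last nonzero iterate. -/
lemma exists_pow_apply_ne_zero_and_succ_eq_zero (X : Module.End F M) {w : M} (hw : w ≠ 0)
    (hX : ∃ n : ℕ, (X ^ n) w = 0) : ∃ n : ℕ, (X ^ n) w ≠ 0 ∧ (X ^ (n + 1)) w = 0 := by
  classical
  have hpos : Nat.find hX ≠ 0 := fun h => hw (by simpa [h] using Nat.find_spec hX)
  obtain ⟨n, hn⟩ := Nat.exists_eq_succ_of_ne_zero hpos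
  exact ⟨n, Nat.find_min hX (by omega), by simpa [hn] using Nat.find_spec hX⟩

/-- If `[T, X] = a X`, then `X ^ n` shifts `T`-eigenvalues by `n a`. -/
lemma apply_pow_apply_of_apply_eq_smul {X T : Module.End F M} {a μ : F} {w : M}
    (hTX : ∀ z, T (X z) = X (T z) + a • X z) (hw : T w = μ • w) (n : ℕ) :
    T ((X ^ n) w) = (μ + n * a) • (X ^ n) w := by
  induction n with
  | zero => simpa using hw
  | succ n ih =>
    rw [pow_succ', Module.End.mul_apply, hTX, ih, map_smul, ← add_smul]
    push_cast
    ring_nf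

/-- The action of the raising operator on the vectors `Y ^ n v` generated by a highest weight
vector `v` in a representation of `osp(1,2)`. -/
lemma osp_raise_pow_apply {X Y T : Module.End F M} {a μ : F} {v : M}
    (hXY : ∀ z, X (Y z) + Y (X z) = T z) (hTY : ∀ z, T (Y z) = Y (T z) + (-a) • Y z)
    (hX : X v = 0) (hv : T v = μ • v) (m : ℕ) :
    X ((Y ^ (2 * m + 1)) v) = (μ - m * a) • (Y ^ (2 * m)) v ∧
      X ((Y ^ (2 * m + 2)) v) = (-(m + 1) * a) • (Y ^ (2 * m + 1)) v := by
  have step (n : ℕ) (b : F) (u : M) (h : X ((Y ^ n) v) = u) (hu : Y u = b • (Y ^ n) v) :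
      X ((Y ^ (n + 1)) v) = (μ - n * a - b) • (Y ^ n) v := by
    rw [pow_succ', Module.End.mul_apply, eq_sub_of_add_eq (hXY _),
      apply_pow_apply_of_apply_eq_smul hTY hv, h, hu, ← sub_smul]
    ring_nf
  have even_step (m : ℕ)
      (h : X ((Y ^ (2 * m + 1)) v) = (μ - m * a) • (Y ^ (2 * m)) v) :
      X ((Y ^ (2 * m + 2)) v) = (-(m + 1) * a) • (Y ^ (2 * m + 1)) v := by
    rw [step (2 * m + 1) (μ - m * a) _ h (by rw [map_smul, pow_succ', Module.End.mul_apply])]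
    push_cast
    ring_nf
  induction m with
  | zero =>
    have h := step 0 0 0 (by simpa using hX) (by simp)
    have h' : X ((Y ^ (2 * 0 + 1)) v) = (μ - (0 : ℕ) * a) • (Y ^ (2 * 0)) v := by
      simpa using h
    exact ⟨h', even_step 0 h'⟩
  | succ m ih =>
    have h' : X ((Y ^ (2 * (m + 1) + 1)) v)
        = (μ - (m + 1 : ℕ) * a) • (Y ^ (2 * (m + 1))) v := by
      rw [show 2 * (m + 1) = 2 * m + 1 + 1 by ring]
      rw [step (2 * m + 1 + 1) (-(m + 1) * a) _ ih.2
        (by rw [map_smul, pow_succ' Y (2 * m + 1), Module.End.mul_apply])]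
      push_cast
      ring_nf
    exact ⟨h', even_step _ h'⟩

/-- In a representation of `osp(1,2)` on which the odd generators act locally nilpotently, every
eigenvalue of the Cartan generator is an integral multiple of the odd root. -/
lemma osp_eigenvalue_integral [CharZero F] {X Y T : Module.End F M} {a μ : F} (ha : a ≠ 0)
    (hXY : ∀ z, X (Y z) + Y (X z) = T z) (hTX : ∀ z, T (X z) = X (T z) + a • X z)
    (hTY : ∀ z, T (Y z) = Y (T z) + (-a) • Y z)
    (hX : ∀ z, ∃ n : ℕ, (X ^ n) z = 0) (hY : ∀ z, ∃ n : ℕ, (Y ^ n) z = 0)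
    {w : M} (hw : w ≠ 0) (hTw : T w = μ • w) : ∃ k : ℤ, μ = k * a := by
  obtain ⟨n, hn, hn'⟩ := exists_pow_apply_ne_zero_and_succ_eq_zero X hw (hX w)
  obtain ⟨k, hk, hk'⟩ := exists_pow_apply_ne_zero_and_succ_eq_zero Y hn (hY _)
  rw [pow_succ', Module.End.mul_apply] at hn'
  have raise := osp_raise_pow_apply hXY hTY hn' (apply_pow_apply_of_apply_eq_smul hTX hTw n)
  obtain ⟨m, rfl | rfl⟩ := Nat.even_or_odd' k
  · have h := (raise m).1
    rw [hk', map_zero, eq_comm, smul_eq_zero_iff_left hk] at h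
    refine ⟨m - n, ?_⟩
    push_cast
    linear_combination h
  · have h := (raise m).2
    rw [hk', map_zero, eq_comm, smul_eq_zero_iff_left hk] at h
    exact absurd h (mul_ne_zero (neg_ne_zero.mpr (Nat.cast_add_one_ne_zero m)) ha)

end Module.End

namespace LieSuperAlgebra

variable {F L : Type} [Field F] [AddCommGroup L] [Module F L] (A : LieSuperAlgebra F L)

lemma bracket_skew_of_even {x y : L} (hx : x ∈ A.carrier 0) {j : ZMod 2}
    (hy : y ∈ A.carrier j) : A.bracket x y = -A.bracket y x := by
  simpa using A.skew 0 j x hx y hy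

lemma bracket_comm_of_odd {x y : L} (hx : x ∈ A.carrier 1) (hy : y ∈ A.carrier 1) :
    A.bracket x y = A.bracket y x := by
  simpa [ZMod.val_one] using A.skew 1 1 x hx y hy

lemma bracket_mem_even_of_odd {x y : L} (hx : x ∈ A.carrier 1) (hy : y ∈ A.carrier 1) :
    A.bracket x y ∈ A.carrier 0 :=
  A.bracket_mem 1 1 x hx y hy

lemma jacobi_of_even {x y : L} (hx : x ∈ A.carrier 0) {j : ZMod 2} (hy : y ∈ A.carrier j)
    (z : L) : A.bracket (A.bracket x y) z
      = A.bracket x (A.bracket y z) - A.bracket y (A.bracket x z) := by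
  simpa using A.super_jacobi 0 j x hx y hy z

lemma jacobi_of_odd {x y : L} (hx : x ∈ A.carrier 1) (hy : y ∈ A.carrier 1) (z : L) :
    A.bracket (A.bracket x y) z
      = A.bracket x (A.bracket y z) + A.bracket y (A.bracket x z) := by
  simpa [ZMod.val_one] using A.super_jacobi 1 1 x hx y hy z

end LieSuperAlgebra

namespace SuperToral

variable {F L : Type} [Field F] [AddCommGroup L] [Module F L] (S : SuperToral F L)

lemma bracket_mem_wt_add {α β : Module.Dual F S.H} {x y : L} {i : ZMod 2}
    (hi : x ∈ S.carrier i) (hx : x ∈ S.wt α) (hy : y ∈ S.wt β) :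
    S.bracket x y ∈ S.wt (α + β) := by
  rw [S.wt_def] at hx hy ⊢
  intro t
  have h := S.jacobi_of_even (S.H_le t.2) hi y
  rw [hx t, hy t, map_smul, map_smul, LinearMap.smul_apply] at h
  rw [LinearMap.add_apply, add_smul, h]
  abel

/-- Weight spaces are graded. -/
lemma homogeneous_wt_ne_bot {α : Module.Dual F S.H} (hα : S.wt α ≠ ⊥) :
    S.carrier 0 ⊓ S.wt α ≠ ⊥ ∨ S.carrier 1 ⊓ S.wt α ≠ ⊥ := by
  obtain ⟨x, hx, hx0⟩ := Submodule.exists_mem_ne_zero_of_ne_bot hα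
  obtain ⟨y, hy, z, hz, rfl⟩ := Submodule.mem_sup.mp
    (S.isCompl.sup_eq_top ▸ Submodule.mem_top : x ∈ S.carrier 0 ⊔ S.carrier 1)
  rw [S.wt_def] at hx
  have key (t : S.H) : S.bracket t y = α t • y ∧ S.bracket t z = α t • z := by
    have hy' : S.bracket t y - α t • y ∈ S.carrier 0 :=
      sub_mem (S.bracket_mem 0 0 t (S.H_le t.2) y hy) (Submodule.smul_mem _ _ hy)
    have hz' : S.bracket t z - α t • z ∈ S.carrier 1 :=
      sub_mem (S.bracket_mem 0 1 t (S.H_le t.2) z hz) (Submodule.smul_mem _ _ hz)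
    have hsum : (S.bracket t y - α t • y) + (S.bracket t z - α t • z) = 0 := by
      have h := hx t
      rw [map_add, smul_add] at h
      rw [← sub_eq_zero] at h
      rw [← h]
      abel
    have hy0 : S.bracket t y - α t • y = 0 := by
      refine Submodule.disjoint_def.mp S.isCompl.disjoint _ hy' ?_
      rw [eq_neg_of_add_eq_zero_left hsum]
      exact neg_mem hz'
    rw [hy0, zero_add] at hsum
    exact ⟨sub_eq_zero.mp hy0, sub_eq_zero.mp hsum⟩
  by_cases hy0 : y = 0
  · right
    refine Submodule.ne_bot_iff _ |>.mpr ⟨z, ⟨hz, (S.wt_def _ _).mpr fun t => (key t).2⟩, ?_⟩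
    simpa [hy0] using hx0
  · left
    exact Submodule.ne_bot_iff _ |>.mpr ⟨y, ⟨hy, (S.wt_def _ _).mpr fun t => (key t).1⟩, hy0⟩

/-- The bracket of elements of opposite weights, if it lies in `H`, is the multiple of the
representative of the weight given by the form. -/
lemma bracket_eq_smul_rep {β : Module.Dual F S.H} {i : ZMod 2} {x y : L}
    (hy : y ∈ S.carrier i ⊓ S.wt (-β)) {t tβ : S.H}
    (hrep : ∀ s : S.H, S.form tβ s = β s) (ht : S.bracket x y = t) :
    t = S.form x y • tβ := by
  rw [← sub_eq_zero]
  refine S.form_H_nondeg _ fun s => ?_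
  have hys : S.bracket y s = β s • y := by
    have h := S.bracket_skew_of_even (S.H_le s.2) hy.1
    rw [(S.wt_def _ _).mp hy.2 s, LinearMap.neg_apply, neg_smul] at h
    exact (neg_inj.mp h).symm
  have h : S.form t s = β s * S.form x y := by
    rw [← ht, S.form_inv, hys, map_smul, smul_eq_mul]
  rw [Submodule.coe_sub, Submodule.coe_smul, map_sub, map_smul, LinearMap.sub_apply,
    LinearMap.smul_apply, hrep, h, smul_eq_mul]
  ring

end SuperToral

namespace EALS

variable {F L : Type} [Field F] [AddCommGroup L] [Module F L] (E : EALS F L)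

/-- A nonisotropic odd root admits opposite odd root vectors on whose bracket it does not
vanish. -/
lemma exists_odd_pair {β : Module.Dual F E.H} {tβ : E.H}
    (hrep : ∀ s : E.H, E.form tβ s = β s) (hββ : E.form tβ tβ ≠ 0)
    (hβ : E.carrier 1 ⊓ E.wt β ≠ ⊥) :
    ∃ x ∈ E.carrier 1 ⊓ E.wt β, ∃ y ∈ E.carrier 1 ⊓ E.wt (-β), ∃ t : E.H,
      E.bracket x y = t ∧ β t ≠ 0 := by
  have hβ0 : β ≠ 0 := fun h => hββ (by simp [hrep, h])
  obtain ⟨x, hx, y, hy, hH, hne⟩ := E.ax1 1 β hβ0 hβ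
  refine ⟨x, hx, y, hy, ⟨_, hH⟩, rfl, ?_⟩
  have h := E.bracket_eq_smul_rep hy (t := ⟨_, hH⟩) hrep rfl
  have hc : E.form x y ≠ 0 := fun hc => hne (by simpa [hc] using congrArg Subtype.val h)
  rw [h, map_smul, ← hrep tβ, smul_eq_mul]
  exact mul_ne_zero hc hββ

/-- If `β` is a nonisotropic odd root, then the double of `β` is an even root. -/
lemma even_two_nsmul_ne_bot [CharZero F] {β : Module.Dual F E.H} {tβ : E.H}
    (hrep : ∀ s : E.H, E.form tβ s = β s) (hββ : E.form tβ tβ ≠ 0)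
    (hβ : E.carrier 1 ⊓ E.wt β ≠ ⊥) : E.carrier 0 ⊓ E.wt (2 • β) ≠ ⊥ := by
  obtain ⟨x, hx, y, hy, t, ht, hβt⟩ := E.exists_odd_pair hrep hββ hβ
  rw [Submodule.ne_bot_iff]
  refine ⟨E.bracket x x, ⟨E.bracket_mem_even_of_odd hx.1 hx.1, ?_⟩, fun h0 => ?_⟩
  · rw [two_nsmul]
    exact E.bracket_mem_wt_add hx.1 hx.2 hx.2
  · have h := E.jacobi_of_odd hx.1 hx.1 y
    have hxt : E.bracket x t = -(β t • x) := by
      rw [← (E.wt_def _ _).mp hx.2 t, E.bracket_skew_of_even (E.H_le t.2) hx.1, neg_neg]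
    rw [h0, map_zero, LinearMap.zero_apply, ht, ← two_smul F, hxt] at h
    have hx0 : x = 0 := by simpa [hβt] using h.symm
    have ht0 : t = 0 := by simpa [hx0] using ht.symm
    simp [ht0] at hβt

/-- Every root takes an integral multiple of `β t` on the coroot direction `t` of a nonisotropic
odd root `β`. -/
lemma root_apply_integral [CharZero F] {β : Module.Dual F E.H} {tβ : E.H}
    (hrep : ∀ s : E.H, E.form tβ s = β s) (hββ : E.form tβ tβ ≠ 0)
    (hβ : E.carrier 1 ⊓ E.wt β ≠ ⊥) :
    ∃ t : E.H, β t ≠ 0 ∧ ∀ α, E.wt α ≠ ⊥ → ∃ k : ℤ, α t = k * β t := by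
  obtain ⟨x, hx, y, hy, t, ht, hβt⟩ := E.exists_odd_pair hrep hββ hβ
  refine ⟨t, hβt, fun α hα => ?_⟩
  obtain ⟨w, hw, hw0⟩ := Submodule.exists_mem_ne_zero_of_ne_bot hα
  have ht0 : (t : L) ≠ 0 := fun h => hβt (by
    rw [show t = 0 from Subtype.ext h, map_zero])
  have hx0 : x ≠ 0 := by
    rintro rfl
    exact ht0 (by simpa using ht.symm)
  have hy0 : y ≠ 0 := by
    rintro rfl
    exact ht0 (by simpa using ht.symm)
  refine Module.End.osp_eigenvalue_integral (X := E.bracket x) (Y := E.bracket y)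
    (T := E.bracket t) hβt (fun z => ?_) (fun z => ?_) (fun z => ?_)
    (E.ax2 β (Submodule.ne_bot_iff _ |>.mpr ⟨x, hx.2, hx0⟩) tβ hrep hββ x hx.2)
    (E.ax2 (-β) (Submodule.ne_bot_iff _ |>.mpr ⟨y, hy.2, hy0⟩) (-tβ)
      (fun s => by simp [hrep]) (by simpa using hββ) y hy.2)
    hw0 ((E.wt_def _ _).mp hw t)
  · rw [← ht, E.jacobi_of_odd hx.1 hy.1]
  · have h := E.jacobi_of_even (E.H_le t.2) hx.1 z
    rw [(E.wt_def _ _).mp hx.2 t, map_smul, LinearMap.smul_apply] at h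
    rw [h]
    abel
  · have h := E.jacobi_of_even (E.H_le t.2) hy.1 z
    rw [(E.wt_def _ _).mp hy.2 t, map_smul, LinearMap.smul_apply, LinearMap.neg_apply] at h
    rw [h]
    abel

end EALS

/-- (a) for a root `α` with `(α,α) ≠ 0`, `2α ∉ R₁`; (b) if moreover
`2α ∉ R`, then `α ∈ R₀`. -/
theorem EALS_double_root
    {F : Type} [Field F] [CharZero F] {L : Type} [AddCommGroup L] [Module F L]
    (E : EALS F L) (α : Module.Dual F ↥E.H) (hα : E.wt α ≠ ⊥)
    (tα : ↥E.H) (hrep : ∀ s : ↥E.H, E.form ↑tα ↑s = α s)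
    (haa : E.form ↑tα ↑tα ≠ 0) :
    E.carrier 1 ⊓ E.wt (2 • α) = ⊥ ∧
    (E.wt (2 • α) = ⊥ → E.carrier 0 ⊓ E.wt α ≠ ⊥) := by
  constructor
  · by_contra h
    obtain ⟨t, ht, hint⟩ := E.root_apply_integral (β := 2 • α) (tβ := 2 • tα)
      (fun s => by simp [hrep]) (by simpa using haa) h
    obtain ⟨k, hk⟩ := hint α hα
    have hαt : α t ≠ 0 := fun h0 => ht (by simp [h0])
    rw [LinearMap.smul_apply, nsmul_eq_mul, ← mul_assoc] at hk
    have h1 : ((k * 2 : ℤ) : F) = (1 : ℤ) := by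
      push_cast
      exact mul_right_cancel₀ hαt (by simpa using hk.symm)
    have := Int.cast_injective h1
    omega
  · intro h2 h0
    have hodd := (E.homogeneous_wt_ne_bot hα).resolve_left (not_not_intro h0)
    exact E.even_two_nsmul_ne_bot hrep haa hodd (by simp [h2])
end
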